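/- Let γ > 0, κ ∈ ℝ with κ² + 2γ(γ−1) ≥ 0 and κ − √(κ² + 2γ(γ−1)) ≠ 0, and set b = κ − √(κ² + 2γ(γ−1)) and ν = arctan(γ/b). Then the function h(ν) = −κ cos³ν − sin³ν − (3γ/2) cos²ν sin ν satisfies h(ν) = −(b/(2|b|))·(γ² + b²)^{−1/2}·(b² + 2γ); in particular h(ν) < 0 if and only if b > 0, i.e. if and only if γ < 1 and κ ≥ √(2γ(1−γ)). -/

import Mathlib

open Real

/-- with `b = κ − √(κ² + 2γ(γ−1)) ≠ 0` and `ν = arctan(γ/b)`,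
the quantity `h(ν) = −κ cos³ν − sin³ν − (3γ/2) cos²ν sin ν` equals
`−(b/(2|b|)) (γ² + b²)^{−1/2} (b² + 2γ)`; in particular `h(ν) < 0` iff `b > 0`,
iff `γ < 1` and `κ ≥ √(2γ(1−γ))`. -/
theorem colin_ohta_J2_computation (γ κ : ℝ) (hγ : 0 < γ)
    (hdisc : 0 ≤ κ ^ 2 + 2 * γ * (γ - 1))
    (b : ℝ) (hb : b = κ - Real.sqrt (κ ^ 2 + 2 * γ * (γ - 1))) (hbne : b ≠ 0)
    (ν : ℝ) (hν : ν = Real.arctan (γ / b)) :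
    (-κ * Real.cos ν ^ 3 - Real.sin ν ^ 3 - (3 * γ / 2) * Real.cos ν ^ 2 * Real.sin ν
        = -(b / (2 * |b|)) * (Real.sqrt (γ ^ 2 + b ^ 2))⁻¹ * (b ^ 2 + 2 * γ))
    ∧ (-κ * Real.cos ν ^ 3 - Real.sin ν ^ 3 - (3 * γ / 2) * Real.cos ν ^ 2 * Real.sin ν < 0
        ↔ 0 < b)
    ∧ (0 < b ↔ γ < 1 ∧ Real.sqrt (2 * γ * (1 - γ)) ≤ κ) := by
  have hs0 := Real.sqrt_nonneg (κ ^ 2 + 2 * γ * (γ - 1))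
  have hs2 := Real.sq_sqrt hdisc
  set s := Real.sqrt (κ ^ 2 + 2 * γ * (γ - 1)) with hs
  have hκ : κ = (b ^ 2 + 2 * γ * (1 - γ)) / (2 * b) := by
    have h1 : s = κ - b := by linarith
    rw [h1] at hs2
    field_simp
    linarith
  have hr : 0 < Real.sqrt (γ ^ 2 + b ^ 2) := Real.sqrt_pos.mpr (by positivity)
  have hr2 : Real.sqrt (γ ^ 2 + b ^ 2) ^ 2 = γ ^ 2 + b ^ 2 := Real.sq_sqrt (by positivity)
  have habs : 0 < |b| := abs_pos.mpr hbne
  have hcos : Real.cos ν = |b| / Real.sqrt (γ ^ 2 + b ^ 2) := by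
    rw [hν, Real.cos_arctan]
    have h1 : 1 + (γ / b) ^ 2 = (γ ^ 2 + b ^ 2) / b ^ 2 := by
      field_simp
      ring
    rw [h1, Real.sqrt_div (by positivity), Real.sqrt_sq_eq_abs, one_div_div]
  have hsin : Real.sin ν = γ / b * Real.cos ν := by
    have h1 : Real.tan ν = γ / b := by rw [hν, Real.tan_arctan]
    have h2 : Real.cos ν ≠ 0 := by rw [hcos]; positivity
    rw [← h1, Real.tan_mul_cos h2]
  have key : -κ * Real.cos ν ^ 3 - Real.sin ν ^ 3 - (3 * γ / 2) * Real.cos ν ^ 2 * Real.sin ν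
        = -(b / (2 * |b|)) * (Real.sqrt (γ ^ 2 + b ^ 2))⁻¹ * (b ^ 2 + 2 * γ) := by
    have e1 : -κ * Real.cos ν ^ 3 - Real.sin ν ^ 3 - (3 * γ / 2) * Real.cos ν ^ 2 * Real.sin ν
        = -((γ ^ 2 + b ^ 2) * (b ^ 2 + 2 * γ) / (2 * b ^ 3)) * Real.cos ν ^ 3 := by
      rw [hsin, hκ]
      field_simp
      ring
    have e2 : |b| ^ 4 = b ^ 4 := by
      rw [show |b| ^ 4 = (|b| ^ 2) ^ 2 by ring, sq_abs]
      ring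
    rw [e1, hcos]
    generalize Real.sqrt (γ ^ 2 + b ^ 2) = r at *
    rw [← hr2]
    field_simp
    linarith [e2]
  refine ⟨key, ?_, ?_⟩
  · rw [key]
    have hP : 0 < (Real.sqrt (γ ^ 2 + b ^ 2))⁻¹ * (b ^ 2 + 2 * γ) := by positivity
    rw [mul_assoc]
    constructor
    · intro h
      by_contra hn
      have h1 : b / (2 * |b|) ≤ 0 := div_nonpos_of_nonpos_of_nonneg (not_lt.mp hn) (by positivity)
      nlinarith
    · intro h
      have h1 : 0 < b / (2 * |b|) := by positivity
      nlinarith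
  · constructor
    · intro h
      have h1 : s < κ := by linarith
      have h2 : s ^ 2 < κ ^ 2 := by nlinarith
      refine ⟨by nlinarith, ?_⟩
      apply Real.sqrt_le_iff.mpr
      exact ⟨by linarith, by nlinarith⟩
    · rintro ⟨h1, h2⟩
      have h3 : 0 ≤ κ := le_trans (Real.sqrt_nonneg _) h2
      have h4 : 0 < γ * (1 - γ) := mul_pos hγ (by linarith)
      have h5 : s < κ := by
        apply lt_of_pow_lt_pow_left₀ 2 h3
        nlinarith
      linarith
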